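/- A random social choice rule φ : D^n → Δ(P) on the single-peaked domain is unanimous, strategy-proof, and group-wise anonymous if and only if it is a probabilistic fixed group ballot rule (PFGBR), i.e., there exists a collection of probability distributions (δ_γ)_{γ∈Γ} over P satisfying (i) ballot unanimity: δ_{γ̲}(p_m) = 1 and δ_{γ̄}(p_1) = 1, and (ii) monotonicity: γ ≫ γ′ implies δ_γ([p_1,p_t]) ≥ δ_{γ′}([p_1,p_t]) for all t ∈ {1,…,m}, such that for all profiles P_N ∈ D^n and all t ∈ {1,…,m}, φ_{p_t}(P_N) = δ_{α(t;P_N)}([p_1,p_t]) − δ_{α(t−1;P_N)}([p_1,p_{t−1}]), with the convention that the term for t−1 = 0 equals 0. Here φ is unanimous if all voters having top project p implies φ_p(P_N) = 1; φ is strategy-proof if for every voter i, profile P_N, and ≻′_i ∈ D, the distribution φ(≻_i, ≻_{−i}) stochastically dominates φ(≻′_i, ≻_{−i}) with respect to ≻_i (i.e., for every p ∈ P, φ assigns the upper contour set U(p,≻_i) = {p} ∪ {p′ : p′ ≻_i p} at least as much probability under the truthful report); and φ is group-wise anonymous if φ(P_N) = φ(P_{π(N)}) for every group-preserving permutation π of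 N. -/

import Mathlib

/-- Projects `p_1 ◁ ⋯ ◁ p_{m+1}`, identified with `Fin (m+1)` with its natural order. -/
abbrev Proj (m : ℕ) := Fin (m + 1)

/-- A preference (strict linear order) over the projects, encoded as a permutation
sending each project to its rank position (position `0` = top). -/
abbrev Pref (m : ℕ) := Equiv.Perm (Proj m)

/-- The top-ranked project of a preference. -/
def topOf {m : ℕ} (r : Pref m) : Proj m := r.symm 0

/-- Single-peakedness of a preference with respect to the prior order `◁` on projects. -/
def SinglePeaked {m : ℕ} (r : Pref m) : Prop :=
  ∀ p q : Proj m, ((topOf r < p ∧ p < q) ∨ (q < p ∧ p < topOf r)) → r p < r q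

/-- The size of group `q` under the group assignment `grp`. -/
def groupSize {n g : ℕ} (grp : Fin n → Fin g) (q : Fin g) : ℕ :=
  (Finset.univ.filter fun i => grp i = q).card

/-- The upper contour set `U(p, r)` of project `p` at preference `r`. -/
def upperContour {m : ℕ} (r : Pref m) (p : Proj m) : Finset (Proj m) :=
  Finset.univ.filter fun q => r q ≤ r p

/-- `α(t; prof)_q`: the number of voters of group `q` whose top-ranked project is among
the first `t` projects `p_1, …, p_t` (so the top has `Fin`-index `< t`). -/
def alphaCount {n m g : ℕ} (prof : Fin n → Pref m) (grp : Fin n → Fin g)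
    (q : Fin g) (t : ℕ) : ℕ :=
  (Finset.univ.filter fun i => grp i = q ∧ (topOf (prof i) : ℕ) < t).card

/-- `δ_{α(t;prof)}([p_1, p_t])`, the cumulative probability of the first `t` projects
under the ballot indexed by `α(t; prof)`; equal to `0` for `t = 0`. -/
def cumAt {n m g : ℕ} (δ : (Fin g → ℕ) → Proj m → ℝ)
    (prof : Fin n → Pref m) (grp : Fin n → Fin g) (t : ℕ) : ℝ :=
  ∑ p ∈ Finset.univ.filter (fun p : Proj m => (p : ℕ) < t),
    δ (fun q => alphaCount prof grp q t) p

namespace PFG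

theorem top_iff {m : ℕ} (r : Pref m) (p : Proj m) : topOf r = p ↔ r p = 0 := by
  unfold topOf
  rw [Equiv.symm_apply_eq]
  exact eq_comm

theorem r_top {m : ℕ} (r : Pref m) : r (topOf r) = 0 := (top_iff r _).1 rfl

theorem mem_uc {m : ℕ} (r : Pref m) (p q : Proj m) : q ∈ upperContour r p ↔ r q ≤ r p := by
  simp [upperContour]

theorem uc_right_sub {m : ℕ} {r : Pref m} (h : SinglePeaked r) {p : Proj m} (hp : topOf r ≤ p) :
    upperContour r p ⊆ Finset.Icc 0 p := by
  intro q hq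
  rw [mem_uc] at hq
  rw [Finset.mem_Icc]
  refine ⟨Fin.zero_le _, ?_⟩
  by_contra hlt
  push Not at hlt
  rcases hp.lt_or_eq with h1 | h1
  · exact absurd (h p q (Or.inl ⟨h1, hlt⟩)) (not_lt.2 hq)
  · have h0 := (top_iff r p).1 h1
    rw [h0] at hq
    have h2 : r q = r p := by rw [h0]; exact le_antisymm hq (Fin.zero_le _)
    exact absurd (r.injective h2) hlt.ne'

theorem uc_left_sub {m : ℕ} {r : Pref m} (h : SinglePeaked r) {p : Proj m} (hp : p ≤ topOf r) :
    upperContour r p ⊆ Finset.Icc p (Fin.last m) := by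
  intro q hq
  rw [mem_uc] at hq
  rw [Finset.mem_Icc]
  refine ⟨?_, Fin.le_last _⟩
  by_contra hlt
  push Not at hlt
  rcases hp.lt_or_eq with h1 | h1
  · exact absurd (h p q (Or.inr ⟨hlt, h1⟩)) (not_lt.2 hq)
  · have h0 := (top_iff r p).1 h1.symm
    rw [h0] at hq
    have h2 : r q = r p := by rw [h0]; exact le_antisymm hq (Fin.zero_le _)
    exact absurd (r.injective h2) hlt.ne

theorem uc_right_sup {m : ℕ} {r : Pref m} (h : SinglePeaked r) (p : Proj m) :
    Finset.Icc (topOf r) p ⊆ upperContour r p := by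
  intro q hq
  rw [Finset.mem_Icc] at hq
  rw [mem_uc]
  rcases hq.1.lt_or_eq with h1 | h1
  · rcases hq.2.lt_or_eq with h2 | h2
    · exact (h q p (Or.inl ⟨h1, h2⟩)).le
    · rw [h2]
  · rw [← h1, r_top]; exact Fin.zero_le _

theorem uc_left_sup {m : ℕ} {r : Pref m} (h : SinglePeaked r) (p : Proj m) :
    Finset.Icc p (topOf r) ⊆ upperContour r p := by
  intro q hq
  rw [Finset.mem_Icc] at hq
  rw [mem_uc]
  rcases hq.2.lt_or_eq with h1 | h1
  · rcases hq.1.lt_or_eq with h2 | h2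
    · exact (h q p (Or.inr ⟨h2, h1⟩)).le
    · rw [h2]
  · rw [h1, r_top]; exact Fin.zero_le _

theorem uc_top {m : ℕ} (r : Pref m) : upperContour r (topOf r) = {topOf r} := by
  ext q
  rw [mem_uc, r_top, Finset.mem_singleton, eq_comm, top_iff]
  exact ⟨fun h => le_antisymm h (Fin.zero_le _), fun h => h.le⟩

theorem uc_interval {m : ℕ} {r : Pref m} (h : SinglePeaked r) (p : Proj m) :
    ∃ x y, x ≤ topOf r ∧ topOf r ≤ y ∧ upperContour r p = Finset.Icc x y := by
  have ht : topOf r ∈ upperContour r p := by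
    rw [mem_uc, r_top]; exact Fin.zero_le _
  have hne : (upperContour r p).Nonempty := ⟨_, ht⟩
  refine ⟨_, _, Finset.min'_le _ _ ht, Finset.le_max' _ _ ht, ?_⟩
  ext q
  constructor
  · intro hq
    exact Finset.mem_Icc.2 ⟨Finset.min'_le _ _ hq, Finset.le_max' _ _ hq⟩
  · intro hq
    rw [Finset.mem_Icc] at hq
    have h1 := Finset.min'_mem _ hne
    have h2 := Finset.max'_mem _ hne
    rw [mem_uc] at h1 h2 ⊢
    rcases le_total q (topOf r) with hc | hc
    · have := uc_left_sup h ((upperContour r p).min' hne) (Finset.mem_Icc.2 ⟨hq.1, hc⟩)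
      rw [mem_uc] at this
      exact this.trans h1
    · have := uc_right_sup h ((upperContour r p).max' hne) (Finset.mem_Icc.2 ⟨hc, hq.2⟩)
      rw [mem_uc] at this
      exact this.trans h2

/-- Preference `a, a-1, …, 0, a+1, …, m`. -/
def Lp {m : ℕ} (a : Proj m) : Pref m where
  toFun p := ⟨if (p : ℕ) ≤ a then a - p else p, by split <;> omega⟩
  invFun p := ⟨if (p : ℕ) ≤ a then a - p else p, by split <;> omega⟩
  left_inv p := by
    ext; simp only; split_ifs <;> omega
  right_inv p := by
    ext; simp only; split_ifs <;> omega

/-- Preference `a, a+1, …, m, a-1, …, 0`. -/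
def Rp {m : ℕ} (a : Proj m) : Pref m where
  toFun p := ⟨if (a : ℕ) ≤ p then p - a else m - p, by split <;> omega⟩
  invFun p := ⟨if (p : ℕ) + a ≤ m then p + a else m - p, by split <;> omega⟩
  left_inv p := by
    ext; simp only; split_ifs <;> omega
  right_inv p := by
    ext; simp only; split_ifs <;> omega

theorem Lp_val {m : ℕ} (a p : Proj m) : (Lp a p : ℕ) = if (p : ℕ) ≤ a then (a : ℕ) - p else p := rfl
theorem Rp_val {m : ℕ} (a p : Proj m) : (Rp a p : ℕ) = if (a : ℕ) ≤ p then (p : ℕ) - a else m - p := rfl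

theorem top_Lp {m : ℕ} (a : Proj m) : topOf (Lp a) = a := by
  rw [top_iff]; ext; simp [Lp_val]

theorem top_Rp {m : ℕ} (a : Proj m) : topOf (Rp a) = a := by
  rw [top_iff]; ext; simp [Rp_val]

theorem sp_Lp {m : ℕ} (a : Proj m) : SinglePeaked (Lp a) := by
  intro p q h
  rw [top_Lp] at h
  simp only [Fin.lt_def, Lp_val] at *
  split_ifs <;> omega

theorem sp_Rp {m : ℕ} (a : Proj m) : SinglePeaked (Rp a) := by
  intro p q h
  rw [top_Rp] at h
  simp only [Fin.lt_def, Rp_val] at *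
  split_ifs <;> omega

theorem uc_Lp {m : ℕ} {a p : Proj m} (h : p ≤ a) : upperContour (Lp a) p = Finset.Icc p a := by
  ext q
  rw [mem_uc, Finset.mem_Icc]
  simp only [Fin.le_def, Lp_val] at *
  split_ifs <;> omega

theorem uc_Rp {m : ℕ} {a p : Proj m} (h : a ≤ p) : upperContour (Rp a) p = Finset.Icc a p := by
  ext q
  rw [mem_uc, Finset.mem_Icc]
  simp only [Fin.le_def, Rp_val] at *
  split_ifs <;> omega

/-- The forward hypotheses without anonymity. -/
structure Good {n m : ℕ} (φ : (Fin n → Pref m) → Proj m → ℝ) : Prop where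
  nonneg : ∀ P : Fin n → Pref m, (∀ i, SinglePeaked (P i)) → ∀ p, 0 ≤ φ P p
  total : ∀ P : Fin n → Pref m, (∀ i, SinglePeaked (P i)) → ∑ p, φ P p = 1
  unan : ∀ P : Fin n → Pref m, (∀ i, SinglePeaked (P i)) →
        ∀ p : Proj m, (∀ i, topOf (P i) = p) → φ P p = 1
  strat : ∀ P : Fin n → Pref m, (∀ i, SinglePeaked (P i)) →
        ∀ (i : Fin n) (r' : Pref m), SinglePeaked r' →
          ∀ p : Proj m,
            ∑ q ∈ upperContour (P i) p, φ (Function.update P i r') q ≤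
              ∑ q ∈ upperContour (P i) p, φ P q

section
variable {n m : ℕ} {φ : (Fin n → Pref m) → Proj m → ℝ}

theorem sp_update {P : Fin n → Pref m} (h : ∀ i, SinglePeaked (P i)) (i : Fin n) {r : Pref m}
    (hr : SinglePeaked r) : ∀ j, SinglePeaked (Function.update P i r j) := by
  intro j
  by_cases hj : j = i
  · subst hj; simpa using hr
  · simpa [hj] using h j

theorem Good.mono (G : Good φ) {P : Fin n → Pref m} (h : ∀ i, SinglePeaked (P i))
    {A B : Finset (Proj m)} (hAB : A ⊆ B) : ∑ q ∈ A, φ P q ≤ ∑ q ∈ B, φ P q :=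
  Finset.sum_le_sum_of_subset_of_nonneg hAB (fun q _ _ => G.nonneg P h q)

theorem Good.le_one (G : Good φ) {P : Fin n → Pref m} (h : ∀ i, SinglePeaked (P i))
    (A : Finset (Proj m)) : ∑ q ∈ A, φ P q ≤ 1 := by
  rw [← G.total P h]; exact G.mono h (Finset.subset_univ _)

theorem Good.full (G : Good φ) {P : Fin n → Pref m} (h : ∀ i, SinglePeaked (P i))
    {A B : Finset (Proj m)} (hAB : A ⊆ B) (hA : 1 ≤ ∑ q ∈ A, φ P q) : ∑ q ∈ B, φ P q = 1 :=
  le_antisymm (G.le_one h B) (hA.trans (G.mono h hAB))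

theorem Good.inter (G : Good φ) {P : Fin n → Pref m} (h : ∀ i, SinglePeaked (P i))
    {A B : Finset (Proj m)} (hA : ∑ q ∈ A, φ P q = 1) (hB : ∑ q ∈ B, φ P q = 1) :
    ∑ q ∈ A ∩ B, φ P q = 1 := by
  have h1 := Finset.sum_union_inter (s₁ := A) (s₂ := B) (f := φ P)
  have h2 := G.le_one h (A ∪ B)
  have h3 := G.le_one h (A ∩ B)
  linarith

theorem Good.zero (G : Good φ) {P : Fin n → Pref m} (h : ∀ i, SinglePeaked (P i))
    {A : Finset (Proj m)} (hA : ∑ q ∈ A, φ P q = 1) (B : Finset (Proj m)) :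
    ∑ q ∈ B, φ P q = ∑ q ∈ A ∩ B, φ P q := by
  have h1 := Finset.sum_union_inter (s₁ := A) (s₂ := B) (f := φ P)
  have h2 := G.full h (Finset.subset_union_left (s₁ := A) (s₂ := B)) hA.ge
  linarith

theorem Good.M (G : Good φ) {P Q : Fin n → Pref m} (hP : ∀ i, SinglePeaked (P i))
    (hQ : ∀ i, SinglePeaked (Q i)) (U : Finset (Proj m))
    (hU : ∀ i, P i = Q i ∨ ∃ p, upperContour (Q i) p = U) :
    ∑ q ∈ U, φ P q ≤ ∑ q ∈ U, φ Q q := by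
  classical
  have key : ∀ s : Finset (Fin n), ∑ q ∈ U, φ P q ≤ ∑ q ∈ U, φ (s.piecewise Q P) q := by
    intro s
    induction s using Finset.induction_on with
    | empty => simp
    | insert j s hj ih =>
      refine ih.trans ?_
      rw [Finset.piecewise_insert]
      have hX : ∀ i, SinglePeaked (s.piecewise Q P i) := by
        intro i
        by_cases hi : i ∈ s <;> simp [hi, hP i, hQ i]
      have hXj : s.piecewise Q P j = P j := by simp [hj]
      rcases hU j with h | ⟨p, h⟩
      · rw [← h, ← hXj, Function.update_eq_self]
      · have := G.strat _ (sp_update hX j (hQ j)) j (s.piecewise Q P j) (hX j) p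
        simpa [h] using this
  have := key Finset.univ
  simpa using this

theorem Good.Meq (G : Good φ) {P Q : Fin n → Pref m} (hP : ∀ i, SinglePeaked (P i))
    (hQ : ∀ i, SinglePeaked (Q i)) (U : Finset (Proj m))
    (hU : ∀ i, P i = Q i ∨ ((∃ p, upperContour (P i) p = U) ∧ ∃ p, upperContour (Q i) p = U)) :
    ∑ q ∈ U, φ P q = ∑ q ∈ U, φ Q q := by
  apply le_antisymm
  · exact G.M hP hQ U fun i => (hU i).imp id (·.2)
  · exact G.M hQ hP U fun i => (hU i).imp Eq.symm (·.1)

theorem Good.topEq (G : Good φ) {P Q : Fin n → Pref m} (hP : ∀ i, SinglePeaked (P i))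
    (hQ : ∀ i, SinglePeaked (Q i)) (p : Proj m)
    (hU : ∀ i, P i = Q i ∨ (topOf (P i) = p ∧ topOf (Q i) = p)) :
    φ P p = φ Q p := by
  have := G.Meq hP hQ {p} fun i => (hU i).imp id fun h =>
    ⟨⟨p, by have := uc_top (P i); rwa [h.1] at this⟩, ⟨p, by have := uc_top (Q i); rwa [h.2] at this⟩⟩
  simpa using this

theorem Good.adj (G : Good φ) {P : Fin n → Pref m} (hP : ∀ i, SinglePeaked (P i))
    (a b : Proj m) (hab : (b : ℕ) = a + 1) (hT : ∀ i, topOf (P i) = a ∨ topOf (P i) = b) :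
    ∑ q ∈ Finset.Icc a b, φ P q = 1 := by
  classical
  have hlt : a < b := by rw [Fin.lt_def]; omega
  have hIcc : Finset.Icc a b = {a, b} := by
    ext q; simp only [Finset.mem_Icc, Finset.mem_insert, Finset.mem_singleton, Fin.le_def, Fin.ext_iff]
    omega
  have hsum : ∀ Q, ∑ q ∈ Finset.Icc a b, φ Q q = φ Q a + φ Q b := by
    intro Q; rw [hIcc, Finset.sum_pair hlt.ne]
  -- profiles
  let Ps : Fin n → Pref m := fun i => if topOf (P i) = a then Rp a else P i
  let Pv : Fin n → Pref m := fun i => if topOf (P i) = a then P i else Lp b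
  let Pw : Fin n → Pref m := fun i => if topOf (P i) = a then Rp a else Lp b
  let Ub : Fin n → Pref m := fun i => if topOf (P i) = a then Rp b else P i
  let Ua : Fin n → Pref m := fun i => if topOf (P i) = a then P i else Lp a
  have sPs : ∀ i, SinglePeaked (Ps i) := by intro i; simp only [Ps]; split_ifs; exacts [sp_Rp _, hP i]
  have sPv : ∀ i, SinglePeaked (Pv i) := by intro i; simp only [Pv]; split_ifs; exacts [hP i, sp_Lp _]
  have sPw : ∀ i, SinglePeaked (Pw i) := by intro i; simp only [Pw]; split_ifs; exacts [sp_Rp _, sp_Lp _]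
  have sUb : ∀ i, SinglePeaked (Ub i) := by intro i; simp only [Ub]; split_ifs; exacts [sp_Rp _, hP i]
  have sUa : ∀ i, SinglePeaked (Ua i) := by intro i; simp only [Ua]; split_ifs; exacts [hP i, sp_Lp _]
  have eUb : φ Ub b = 1 := G.unan _ sUb b fun i => by
    simp only [Ub]; split_ifs with h
    · exact top_Rp _
    · exact (hT i).resolve_left h
  have eUa : φ Ua a = 1 := G.unan _ sUa a fun i => by
    simp only [Ua]; split_ifs with h
    · exact h
    · exact top_Lp _
  have e1 : ∑ q ∈ Finset.Icc a b, φ Ps q = 1 := by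
    refine le_antisymm (G.le_one sPs _) ?_
    have h1 : ∑ q ∈ Finset.Icc a b, φ Ub q ≤ ∑ q ∈ Finset.Icc a b, φ Ps q := by
      refine G.M sUb sPs _ fun i => ?_
      simp only [Ub, Ps]; split_ifs
      · exact Or.inr ⟨b, uc_Rp hlt.le⟩
      · exact Or.inl rfl
    have := G.nonneg _ sUb a
    have := hsum Ub
    linarith
  have e2 : ∑ q ∈ Finset.Icc a b, φ Pv q = 1 := by
    refine le_antisymm (G.le_one sPv _) ?_
    have h1 : ∑ q ∈ Finset.Icc a b, φ Ua q ≤ ∑ q ∈ Finset.Icc a b, φ Pv q := by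
      refine G.M sUa sPv _ fun i => ?_
      simp only [Ua, Pv]; split_ifs
      · exact Or.inl rfl
      · exact Or.inr ⟨a, uc_Lp hlt.le⟩
    have := G.nonneg _ sUa b
    have := hsum Ua
    linarith
  have e3 : ∑ q ∈ Finset.Icc a b, φ Pw q = 1 := by
    refine le_antisymm (G.le_one sPw _) ?_
    rw [← e2]
    refine G.M sPv sPw _ fun i => ?_
    simp only [Pv, Pw]; split_ifs
    · exact Or.inr ⟨b, uc_Rp hlt.le⟩
    · exact Or.inl rfl
  -- φ P a = φ Ps a ; φ Pv a = φ Pw a ; φ P b = φ Pv b ; φ Ps b = φ Pw b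
  have f1 : φ P a = φ Ps a := G.topEq hP sPs a fun i => by
    simp only [Ps]; split_ifs with h
    · exact Or.inr ⟨h, top_Rp _⟩
    · exact Or.inl rfl
  have f2 : φ Pv a = φ Pw a := G.topEq sPv sPw a fun i => by
    simp only [Pv, Pw]; split_ifs with h
    · exact Or.inr ⟨h, top_Rp _⟩
    · exact Or.inl rfl
  have f3 : φ P b = φ Pv b := G.topEq hP sPv b fun i => by
    simp only [Pv]; split_ifs with h
    · exact Or.inl rfl
    · exact Or.inr ⟨(hT i).resolve_left h, top_Lp _⟩
  have f4 : φ Ps b = φ Pw b := G.topEq sPs sPw b fun i => by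
    simp only [Ps, Pw]; split_ifs with h
    · exact Or.inl rfl
    · exact Or.inr ⟨(hT i).resolve_left h, top_Lp _⟩
  rw [hsum] at *
  linarith

theorem Good.pareto (G : Good φ) : ∀ d : ℕ, ∀ a b : Proj m, (b : ℕ) = a + d →
    ∀ P : Fin n → Pref m, (∀ i, SinglePeaked (P i)) →
    (∀ i, a ≤ topOf (P i) ∧ topOf (P i) ≤ b) → ∑ q ∈ Finset.Icc a b, φ P q = 1 := by
  classical
  intro d
  induction d with
  | zero =>
    intro a b hab P hP hT
    have : b = a := Fin.ext (by omega)
    subst this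
    have := G.unan P hP b fun i => le_antisymm (hT i).2 (hT i).1
    simpa using this
  | succ d ih =>
    intro a b hab
    rcases Nat.eq_zero_or_pos d with hd | hd
    · subst hd
      intro P hP hT
      refine G.adj hP a b hab fun i => ?_
      have := hT i
      simp only [Fin.le_def] at this
      simp only [Fin.ext_iff]
      omega
    have hc : (a : ℕ) + 1 < m + 1 := by omega
    have hb : (b : ℕ) - 1 < m + 1 := by omega
    set c : Proj m := ⟨a + 1, hc⟩ with hcdef
    have hac : a < c := by simp [Fin.lt_def, c]
    have hcb : c < b := by simp only [Fin.lt_def, c]; omega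
    have inner : ∀ N : ℕ, ∀ P : Fin n → Pref m, (∀ i, SinglePeaked (P i)) →
        (∀ i, a ≤ topOf (P i) ∧ topOf (P i) ≤ b) →
        (Finset.univ.filter fun i => topOf (P i) = a ∨ topOf (P i) = b).card = N →
        ∑ q ∈ Finset.Icc a b, φ P q = 1 := by
      intro N
      induction N using Nat.strong_induction_on with
      | _ N ihN =>
      intro P hP hT hN
      by_cases hA : ∃ i, topOf (P i) = a
      swap
      · push Not at hA
        have := ih c b (by simp only [c]; omega) P hP fun i => ⟨by
          have := lt_of_le_of_ne (hT i).1 (hA i).symm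
          simp only [Fin.lt_def] at this
          simp only [Fin.le_def, c]; omega, (hT i).2⟩
        exact G.full hP (Finset.Icc_subset_Icc hac.le le_rfl) this.ge
      by_cases hB : ∃ i, topOf (P i) = b
      swap
      · push Not at hB
        have := ih a ⟨b - 1, hb⟩ (by simp only; omega) P hP fun i => ⟨(hT i).1, by
          have := lt_of_le_of_ne (hT i).2 (hB i)
          simp only [Fin.lt_def] at this
          simp only [Fin.le_def]; omega⟩
        exact G.full hP (Finset.Icc_subset_Icc le_rfl (by simp [Fin.le_def])) this.ge
      have step : ∀ i, (topOf (P i) = a ∨ topOf (P i) = b) →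
          ∑ q ∈ Finset.Icc a b, φ (Function.update P i (Rp c)) q = 1 := by
        intro i hi
        have hs := sp_update hP i (sp_Rp c)
        refine ihN _ ?_ _ hs ?_ rfl
        · rw [← hN]
          apply Finset.card_lt_card
          rw [Finset.ssubset_iff_of_subset]
          · refine ⟨i, by simpa using hi, ?_⟩
            simp [top_Rp, hac.ne', hcb.ne]
          · intro j hj
            by_cases hji : j = i
            · subst hji; simpa using hi
            · simpa [hji] using hj
        · intro j
          by_cases hji : j = i
          · subst hji; simp [top_Rp, hac.le, hcb.le]
          · simpa [hji] using hT j
      obtain ⟨i, hi⟩ := hA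
      obtain ⟨j, hj⟩ := hB
      have hle : a ≤ b := (hac.trans hcb).le
      have h1 : ∑ q ∈ Finset.Icc 0 b, φ P q = 1 := by
        have e := step i (Or.inl hi)
        have e2 := G.full (B := upperContour (P i) b) (sp_update hP i (sp_Rp c))
          (by have := uc_right_sup (hP i) b; rwa [hi] at this) e.ge
        exact G.full hP (uc_right_sub (hP i) (hi.trans_le hle))
          (e2.ge.trans (G.strat P hP i _ (sp_Rp c) b))
      have h2 : ∑ q ∈ Finset.Icc a (Fin.last m), φ P q = 1 := by
        have e := step j (Or.inr hj)
        have e2 := G.full (B := upperContour (P j) a) (sp_update hP j (sp_Rp c))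
          (by have := uc_left_sup (hP j) a; rwa [hj] at this) e.ge
        exact G.full hP (uc_left_sub (hP j) (hle.trans_eq hj.symm))
          (e2.ge.trans (G.strat P hP j _ (sp_Rp c) a))
      have h3 := G.inter hP h1 h2
      have h4 : Finset.Icc 0 b ∩ Finset.Icc a (Fin.last m) = Finset.Icc a b := by
        ext q; simp [Fin.le_last, and_comm]
      rwa [h4] at h3
    intro P hP hT
    exact inner _ P hP hT rfl

theorem Good.par_lo (G : Good φ) (a : Proj m) {P : Fin n → Pref m} (hP : ∀ i, SinglePeaked (P i))
    (hT : ∀ i, a ≤ topOf (P i)) : ∑ q ∈ Finset.Icc a (Fin.last m), φ P q = 1 :=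
  G.pareto (m - a) a (Fin.last m) (by simp only [Fin.val_last]; omega) P hP
    fun i => ⟨hT i, Fin.le_last _⟩

theorem Good.par_hi (G : Good φ) (a : Proj m) {P : Fin n → Pref m} (hP : ∀ i, SinglePeaked (P i))
    (hT : ∀ i, topOf (P i) ≤ a) : ∑ q ∈ Finset.Icc 0 a, φ P q = 1 :=
  G.pareto a 0 a (by simp) P hP fun i => ⟨Fin.zero_le _, hT i⟩

theorem Good.stepL (G : Good φ) (a : Proj m) {P : Fin n → Pref m} (hP : ∀ i, SinglePeaked (P i))
    (i : Fin n) (hi : topOf (P i) ≤ a) (hmin : ∀ j, topOf (P i) ≤ topOf (P j)) :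
    ∑ q ∈ Finset.Icc 0 a, φ P q = ∑ q ∈ Finset.Icc 0 a, φ (Function.update P i (Lp a)) q := by
  have hs := sp_update hP i (sp_Lp a)
  apply le_antisymm
  · refine G.M hP hs _ fun j => ?_
    by_cases hj : j = i
    · subst hj; right; exact ⟨0, by simpa using uc_Lp (Fin.zero_le _)⟩
    · left; simp [hj]
  · have h1 := G.par_lo (topOf (P i)) hs (fun j => by
      by_cases hj : j = i
      · subst hj; simpa [top_Lp] using hi
      · simpa [hj] using hmin j)
    rw [G.zero hs h1]
    have h2 : Finset.Icc (topOf (P i)) (Fin.last m) ∩ Finset.Icc 0 a ⊆ upperContour (P i) a := by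
      refine Finset.Subset.trans ?_ (uc_right_sup (hP i) a)
      intro q; simp only [Finset.mem_inter, Finset.mem_Icc]; tauto
    exact (G.mono hs h2).trans ((G.strat P hP i _ (sp_Lp a) a).trans
      (G.mono hP (uc_right_sub (hP i) hi)))

theorem Good.stepR (G : Good φ) (a : Proj m) {P : Fin n → Pref m} (hP : ∀ i, SinglePeaked (P i))
    (i : Fin n) (hi : a ≤ topOf (P i)) (hmax : ∀ j, topOf (P j) ≤ topOf (P i)) :
    ∑ q ∈ Finset.Icc a (Fin.last m), φ P q =
      ∑ q ∈ Finset.Icc a (Fin.last m), φ (Function.update P i (Rp a)) q := by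
  have hs := sp_update hP i (sp_Rp a)
  apply le_antisymm
  · refine G.M hP hs _ fun j => ?_
    by_cases hj : j = i
    · subst hj; right; exact ⟨Fin.last m, by simpa using uc_Rp (Fin.le_last _)⟩
    · left; simp [hj]
  · have h1 := G.par_hi (topOf (P i)) hs (fun j => by
      by_cases hj : j = i
      · subst hj; simpa [top_Rp] using hi
      · simpa [hj] using hmax j)
    rw [G.zero hs h1]
    have h2 : Finset.Icc 0 (topOf (P i)) ∩ Finset.Icc a (Fin.last m) ⊆ upperContour (P i) a := by
      refine Finset.Subset.trans ?_ (uc_left_sup (hP i) a)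
      intro q; simp only [Finset.mem_inter, Finset.mem_Icc]; tauto
    exact (G.mono hs h2).trans ((G.strat P hP i _ (sp_Rp a) a).trans
      (G.mono hP (uc_left_sub (hP i) hi)))

theorem Good.allL (G : Good φ) (a : Proj m) : ∀ N : ℕ, ∀ P : Fin n → Pref m,
    (∀ i, SinglePeaked (P i)) →
    (Finset.univ.filter fun i => topOf (P i) ≤ a ∧ P i ≠ Lp a).card = N →
    ∑ q ∈ Finset.Icc 0 a, φ P q =
      ∑ q ∈ Finset.Icc 0 a, φ (fun i => if topOf (P i) ≤ a then Lp a else P i) q := by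
  classical
  intro N
  induction N with
  | zero =>
    intro P hP hN
    refine congrArg (fun Z => ∑ q ∈ Finset.Icc 0 a, φ Z q) ?_
    funext i
    rw [Finset.card_eq_zero, Finset.filter_eq_empty_iff] at hN
    have := hN (Finset.mem_univ i)
    split_ifs with h
    · by_contra hne; exact this ⟨h, hne⟩
    · rfl
  | succ N ih =>
    intro P hP hN
    have hne : (Finset.univ.filter fun i => topOf (P i) ≤ a ∧ P i ≠ Lp a).Nonempty := by
      rw [← Finset.card_pos]; omega
    obtain ⟨i, hi, hmin⟩ := Finset.exists_min_image _ (fun i => topOf (P i)) hne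
    have hi' := (Finset.mem_filter.1 hi).2
    rw [G.stepL a hP i hi'.1, ih _ (sp_update hP i (sp_Lp a))]
    · refine congrArg (fun Z => ∑ q ∈ Finset.Icc 0 a, φ Z q) ?_
      funext j
      by_cases hj : j = i
      · subst hj; simp [top_Lp, hi'.1]
      · simp [hj]
    · have : (Finset.univ.filter fun j => topOf (Function.update P i (Lp a) j) ≤ a ∧
          Function.update P i (Lp a) j ≠ Lp a) =
          (Finset.univ.filter fun i => topOf (P i) ≤ a ∧ P i ≠ Lp a).erase i := by
        ext j
        by_cases hj : j = i
        · subst hj; simp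
        · simp [hj]
      rw [this, Finset.card_erase_of_mem hi, hN]; rfl
    · intro j
      by_cases h1 : topOf (P j) ≤ a
      · by_cases h2 : P j = Lp a
        · rw [h2, top_Lp]; exact hi'.1
        · exact hmin j (by simp [h1, h2])
      · exact hi'.1.trans (not_le.1 h1).le

theorem Good.allR (G : Good φ) (a : Proj m) : ∀ N : ℕ, ∀ P : Fin n → Pref m,
    (∀ i, SinglePeaked (P i)) →
    (Finset.univ.filter fun i => a ≤ topOf (P i) ∧ P i ≠ Rp a).card = N →
    ∑ q ∈ Finset.Icc a (Fin.last m), φ P q =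
      ∑ q ∈ Finset.Icc a (Fin.last m), φ (fun i => if a ≤ topOf (P i) then Rp a else P i) q := by
  classical
  intro N
  induction N with
  | zero =>
    intro P hP hN
    refine congrArg (fun Z => ∑ q ∈ Finset.Icc a (Fin.last m), φ Z q) ?_
    funext i
    rw [Finset.card_eq_zero, Finset.filter_eq_empty_iff] at hN
    have := hN (Finset.mem_univ i)
    split_ifs with h
    · by_contra hne; exact this ⟨h, hne⟩
    · rfl
  | succ N ih =>
    intro P hP hN
    have hne : (Finset.univ.filter fun i => a ≤ topOf (P i) ∧ P i ≠ Rp a).Nonempty := by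
      rw [← Finset.card_pos]; omega
    obtain ⟨i, hi, hmax⟩ := Finset.exists_max_image _ (fun i => topOf (P i)) hne
    have hi' := (Finset.mem_filter.1 hi).2
    rw [G.stepR a hP i hi'.1, ih _ (sp_update hP i (sp_Rp a))]
    · refine congrArg (fun Z => ∑ q ∈ Finset.Icc a (Fin.last m), φ Z q) ?_
      funext j
      by_cases hj : j = i
      · subst hj; simp [top_Rp, hi'.1]
      · simp [hj]
    · have : (Finset.univ.filter fun j => a ≤ topOf (Function.update P i (Rp a) j) ∧
          Function.update P i (Rp a) j ≠ Rp a) =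
          (Finset.univ.filter fun i => a ≤ topOf (P i) ∧ P i ≠ Rp a).erase i := by
        ext j
        by_cases hj : j = i
        · subst hj; simp
        · simp [hj]
      rw [this, Finset.card_erase_of_mem hi, hN]; rfl
    · intro j
      by_cases h1 : a ≤ topOf (P j)
      · by_cases h2 : P j = Rp a
        · rw [h2, top_Rp]; exact hi'.1
        · exact hmax j (by simp [h1, h2])
      · exact (not_le.1 h1).le.trans hi'.1

/-- The canonical profile of a coalition. -/
def can (m : ℕ) {n : ℕ} (S : Finset (Fin n)) : Fin n → Pref m :=
  fun i => if i ∈ S then Rp 0 else Lp (Fin.last m)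

theorem sp_can (S : Finset (Fin n)) : ∀ i, SinglePeaked (can m S i) := by
  intro i; unfold can; split_ifs; exacts [sp_Rp _, sp_Lp _]

theorem Good.compl (G : Good φ) {P : Fin n → Pref m} (hP : ∀ i, SinglePeaked (P i))
    {a b : Proj m} (hab : (b : ℕ) = a + 1) :
    ∑ q ∈ Finset.Icc 0 a, φ P q = 1 - ∑ q ∈ Finset.Icc b (Fin.last m), φ P q := by
  have h : Finset.Icc b (Fin.last m) = (Finset.Icc 0 a)ᶜ := by
    ext q
    simp only [Finset.mem_Icc, Finset.mem_compl, Fin.le_def, Fin.val_last, Fin.val_zero]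
    omega
  rw [h, ← G.total P hP, ← Finset.sum_add_sum_compl (Finset.Icc 0 a)]
  ring

theorem Good.main (G : Good φ) {P : Fin n → Pref m} (hP : ∀ i, SinglePeaked (P i))
    {a b : Proj m} (hab : (b : ℕ) = a + 1) :
    ∑ q ∈ Finset.Icc 0 a, φ P q =
      ∑ q ∈ Finset.Icc 0 a, φ (can m (Finset.univ.filter fun i => topOf (P i) ≤ a)) q := by
  classical
  have hlt : a < b := by rw [Fin.lt_def]; omega
  have hcases : ∀ q : Proj m, b ≤ q ↔ ¬ q ≤ a := by
    intro q; simp only [Fin.le_def]; omega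
  rw [G.allL a _ P hP rfl]
  set P1 : Fin n → Pref m := fun i => if topOf (P i) ≤ a then Lp a else P i with hP1
  have s1 : ∀ i, SinglePeaked (P1 i) := by
    intro i; simp only [P1]; split_ifs; exacts [sp_Lp _, hP i]
  rw [G.compl s1 hab, G.allR b _ P1 s1 rfl]
  set P2 : Fin n → Pref m := fun i => if b ≤ topOf (P1 i) then Rp b else P1 i with hP2
  have e2 : P2 = fun i => if topOf (P i) ≤ a then Lp a else Rp b := by
    funext i
    simp only [P2, P1]
    split_ifs with h1 h2 h2 <;> simp_all [top_Lp]
  have s2 : ∀ i, SinglePeaked (P2 i) := by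
    intro i; rw [e2]; simp only; split_ifs; exacts [sp_Lp _, sp_Rp _]
  let P3 : Fin n → Pref m := fun i => if topOf (P i) ≤ a then Lp a else Lp (Fin.last m)
  have s3 : ∀ i, SinglePeaked (P3 i) := by
    intro i; simp only [P3]; split_ifs; exacts [sp_Lp _, sp_Lp _]
  have h3 := G.Meq s2 s3 (Finset.Icc b (Fin.last m)) fun i => by
    rw [e2]; simp only [P3]; split_ifs with h
    · exact Or.inl rfl
    · exact Or.inr ⟨⟨_, uc_Rp (Fin.le_last _)⟩, ⟨_, uc_Lp (Fin.le_last _)⟩⟩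
  rw [h3, ← G.compl s3 hab]
  refine G.Meq s3 (sp_can _) _ fun i => ?_
  simp only [P3, can, Finset.mem_filter, Finset.mem_univ, true_and]; split_ifs with h
  · exact Or.inr ⟨⟨_, uc_Lp (Fin.zero_le _)⟩, ⟨_, uc_Rp (Fin.zero_le _)⟩⟩
  · exact Or.inl rfl

theorem Good.can_mono (G : Good φ) {S T : Finset (Fin n)} (h : S ⊆ T) (t : Proj m) :
    ∑ q ∈ Finset.Icc 0 t, φ (can m S) q ≤ ∑ q ∈ Finset.Icc 0 t, φ (can m T) q := by
  refine G.M (sp_can _) (sp_can _) _ fun i => ?_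
  unfold can
  by_cases hT : i ∈ T
  · right; refine ⟨t, ?_⟩; rw [if_pos hT]; exact uc_Rp (Fin.zero_le _)
  · left; rw [if_neg hT, if_neg fun hS => hT (h hS)]

end

end PFG
namespace PFG

/-- Number of members of a coalition in each group. -/
def cnt {n g : ℕ} (grp : Fin n → Fin g) (S : Finset (Fin n)) (q : Fin g) : ℕ :=
  (S.filter fun i => grp i = q).card

theorem cnt_le {n g : ℕ} (grp : Fin n → Fin g) (S : Finset (Fin n)) (q : Fin g) :
    cnt grp S q ≤ groupSize grp q :=
  Finset.card_le_card (Finset.filter_subset_filter _ (Finset.subset_univ S))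

theorem cnt_univ {n g : ℕ} (grp : Fin n → Fin g) (q : Fin g) :
    cnt grp Finset.univ q = groupSize grp q := rfl

theorem exists_sub {n g : ℕ} (grp : Fin n → Fin g) (T : Finset (Fin n)) (γ : Fin g → ℕ)
    (h : ∀ q, γ q ≤ cnt grp T q) : ∃ S ⊆ T, cnt grp S = γ := by
  classical
  have h1 : ∀ q, ∃ s ⊆ T.filter (fun i => grp i = q), s.card = γ q := fun q =>
    Finset.exists_subset_card_eq (h q)
  choose s hs hc using h1
  refine ⟨T.filter (fun i => i ∈ s (grp i)), Finset.filter_subset _ _, ?_⟩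
  funext q
  rw [← hc q, cnt]
  congr 1
  ext i
  simp only [Finset.mem_filter]
  constructor
  · rintro ⟨⟨_, h2⟩, rfl⟩; exact h2
  · intro hi
    have := Finset.mem_filter.1 (hs q hi)
    obtain ⟨h3, rfl⟩ := this
    exact ⟨⟨h3, hi⟩, rfl⟩

theorem exists_perm {n g : ℕ} (grp : Fin n → Fin g) (S T : Finset (Fin n))
    (h : cnt grp S = cnt grp T) :
    ∃ π : Equiv.Perm (Fin n), (∀ i, grp (π i) = grp i) ∧ ∀ i, π i ∈ T ↔ i ∈ S := by
  classical
  have hcard : ∀ (S : Finset (Fin n)) (q : Fin g),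
      (Finset.univ.filter fun i => (grp i, decide (i ∈ S)) = (q, true)).card = cnt grp S q ∧
      (Finset.univ.filter fun i => (grp i, decide (i ∈ S)) = (q, false)).card + cnt grp S q
        = groupSize grp q := by
    intro S q
    have e1 : (Finset.univ.filter fun i => (grp i, decide (i ∈ S)) = (q, true)) =
        S.filter fun i => grp i = q := by
      ext i; simp [and_comm]
    have e2 : (Finset.univ.filter fun i => (grp i, decide (i ∈ S)) = (q, false)) =
        (Finset.univ.filter fun i => grp i = q).filter fun i => ¬ i ∈ S := by
      ext i; simp
    have e3 : (S.filter fun i => grp i = q) =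
        (Finset.univ.filter fun i => grp i = q).filter fun i => i ∈ S := by
      ext i; simp [and_comm]
    refine ⟨by rw [e1]; rfl, ?_⟩
    rw [e2, cnt, e3, add_comm]
    exact Finset.card_filter_add_card_filter_not _
  have e : ∀ c : Fin g × Bool, Nonempty ({i // (grp i, decide (i ∈ S)) = c} ≃
      {i // (grp i, decide (i ∈ T)) = c}) := by
    rintro ⟨q, b⟩
    apply Fintype.card_eq.1
    rw [Fintype.card_subtype, Fintype.card_subtype]
    have h1 := hcard S q
    have h2 := hcard T q
    rw [h] at h1
    cases b
    · omega
    · omega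
  let E : ∀ c : Fin g × Bool, ({i // (grp i, decide (i ∈ S)) = c} ≃
      {i // (grp i, decide (i ∈ T)) = c}) := fun c => (e c).some
  have key := Equiv.ofFiberEquiv_map E
  refine ⟨Equiv.ofFiberEquiv E, fun i => ?_, fun i => ?_⟩
  · exact congrArg Prod.fst (key i)
  · have := congrArg Prod.snd (key i)
    simpa using this

theorem filter_lt_eq {m : ℕ} (a : Proj m) :
    (Finset.univ.filter fun p : Proj m => (p : ℕ) < (a : ℕ) + 1) = Finset.Icc 0 a := by
  ext q
  simp only [Finset.mem_filter, Finset.mem_univ, true_and, Finset.mem_Icc, Fin.val_zero, Nat.zero_le, Fin.le_def]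
  omega

theorem filter_le_eq {m : ℕ} (a : Proj m) :
    (Finset.univ.filter fun p : Proj m => p ≤ a) = Finset.Icc 0 a := by
  ext q
  simp

theorem alpha_le {n m g : ℕ} (P : Fin n → Pref m) (grp : Fin n → Fin g) (q : Fin g) (t : ℕ) :
    alphaCount P grp q t ≤ groupSize grp q := by
  apply Finset.card_le_card
  intro i
  simp only [Finset.mem_filter]
  tauto

theorem cumAt_zero {n m g : ℕ} (δ : (Fin g → ℕ) → Proj m → ℝ)
    (P : Fin n → Pref m) (grp : Fin n → Fin g) : cumAt δ P grp 0 = 0 := by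
  simp [cumAt]

theorem cumAt_succ {n m g : ℕ} (δ : (Fin g → ℕ) → Proj m → ℝ)
    (P : Fin n → Pref m) (grp : Fin n → Fin g) (a : Proj m) :
    cumAt δ P grp ((a : ℕ) + 1) =
      ∑ p ∈ Finset.Icc 0 a, δ (fun q => alphaCount P grp q (a + 1)) p := by
  rw [cumAt, filter_lt_eq]

theorem alpha_cnt {n m g : ℕ} (P : Fin n → Pref m) (grp : Fin n → Fin g) (a : Proj m) :
    (fun q => alphaCount P grp q (a + 1)) =
      cnt grp (Finset.univ.filter fun i => topOf (P i) ≤ a) := by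
  funext q
  unfold alphaCount cnt
  congr 1
  ext i
  simp only [Finset.mem_filter, Finset.mem_univ, true_and, Fin.le_def]
  omega

theorem forward {n m g : ℕ} (grp : Fin n → Fin g)
    (φ : (Fin n → Pref m) → Proj m → ℝ) (G : Good φ)
    (hanon : ∀ prof : Fin n → Pref m, (∀ i, SinglePeaked (prof i)) →
        ∀ π : Equiv.Perm (Fin n), (∀ i, grp (π i) = grp i) →
          φ prof = φ fun i => prof (π i)) :
    ∃ δ : (Fin g → ℕ) → Proj m → ℝ,
      (∀ γ : Fin g → ℕ, (∀ q, γ q ≤ groupSize grp q) →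
        (∀ p, 0 ≤ δ γ p) ∧ ∑ p, δ γ p = 1) ∧
      δ (fun _ => 0) (Fin.last m) = 1 ∧
      δ (fun q => groupSize grp q) 0 = 1 ∧
      (∀ γ γ' : Fin g → ℕ, (∀ q, γ q ≤ groupSize grp q) → (∀ q, γ' q ≤ γ q) →
        ∀ t : Proj m,
          ∑ p ∈ Finset.univ.filter (fun p => p ≤ t), δ γ' p ≤
            ∑ p ∈ Finset.univ.filter (fun p => p ≤ t), δ γ p) ∧
      (∀ prof : Fin n → Pref m, (∀ i, SinglePeaked (prof i)) →
        ∀ t : Proj m,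
          φ prof t = cumAt δ prof grp ((t : ℕ) + 1) - cumAt δ prof grp (t : ℕ)) := by
  classical
  have hcan : ∀ S T : Finset (Fin n), cnt grp S = cnt grp T → φ (can m S) = φ (can m T) := by
    intro S T h
    obtain ⟨π, h1, h2⟩ := exists_perm grp S T h
    rw [hanon (can m T) (sp_can T) π h1]
    congr 1
    funext i
    simp only [can, h2]
  have hS : ∀ γ : Fin g → ℕ, ∃ S : Finset (Fin n), (∀ q, γ q ≤ groupSize grp q) → cnt grp S = γ := by
    intro γ
    by_cases h : ∀ q, γ q ≤ groupSize grp q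
    · obtain ⟨S, _, hS⟩ := exists_sub grp Finset.univ γ h
      exact ⟨S, fun _ => hS⟩
    · exact ⟨∅, fun h' => absurd h' h⟩
  choose S hS using hS
  have hδ : ∀ T : Finset (Fin n), φ (can m (S (cnt grp T))) = φ (can m T) := fun T =>
    hcan _ _ (hS _ (cnt_le grp T))
  refine ⟨fun γ => φ (can m (S γ)), ?_, ?_, ?_, ?_, ?_⟩
  · intro γ _
    exact ⟨G.nonneg _ (sp_can _), G.total _ (sp_can _)⟩
  · have h0 : (fun _ => 0 : Fin g → ℕ) = cnt grp ∅ := by funext q; simp [cnt]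
    rw [h0]
    beta_reduce
    rw [hδ]
    exact G.unan _ (sp_can _) _ fun i => by simp [can, top_Lp]
  · have h0 : (fun q => groupSize grp q : Fin g → ℕ) = cnt grp Finset.univ := by
      funext q; exact (cnt_univ grp q).symm
    rw [h0]
    beta_reduce
    rw [hδ]
    exact G.unan _ (sp_can _) _ fun i => by simp [can, top_Rp]
  · intro γ γ' h h' t
    rw [filter_le_eq]
    obtain ⟨T, hT, hc⟩ := exists_sub grp (S γ) γ' (by rw [hS γ h]; exact h')
    rw [← hc]
    beta_reduce
    rw [hδ]
    exact G.can_mono hT t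
  · intro P hP
    have key : ∀ t : Proj m, cumAt (fun γ => φ (can m (S γ))) P grp ((t : ℕ) + 1) =
        ∑ p ∈ Finset.Icc 0 t, φ P p := by
      intro t
      rw [cumAt_succ, alpha_cnt, hδ]
      by_cases ht : (t : ℕ) + 1 < m + 1
      · exact (G.main hP (a := t) (b := ⟨t + 1, ht⟩) rfl).symm
      · have : Finset.Icc 0 t = Finset.univ := by
          ext q; simp only [Finset.mem_Icc, Fin.val_zero, Nat.zero_le, Fin.le_def, Finset.mem_univ, true_and, iff_true]
          omega
        rw [this, G.total _ (sp_can _), G.total _ hP]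
    intro t
    rw [key]
    by_cases ht : (t : ℕ) = 0
    · rw [ht, cumAt_zero]
      have : t = 0 := Fin.ext ht
      subst this
      simp
    · have h1 : ((⟨t - 1, by omega⟩ : Proj m) : ℕ) + 1 = t := by simp only; omega
      have h2 := key ⟨t - 1, by omega⟩
      rw [h1] at h2
      rw [h2]
      have h3 : Finset.Icc 0 t = insert t (Finset.Icc 0 (⟨t - 1, by omega⟩ : Proj m)) := by
        ext q
        simp only [Finset.mem_Icc, Fin.val_zero, Nat.zero_le, Fin.le_def, Finset.mem_insert, true_and, Fin.ext_iff]
        omega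
      rw [h3, Finset.sum_insert]
      · ring
      · simp only [Finset.mem_Icc, Fin.val_zero, Nat.zero_le, Fin.le_def, true_and]
        omega

theorem sum_tele {m : ℕ} (f : Proj m → ℝ) (c : ℕ → ℝ) (h : ∀ p : Proj m, f p = c (p + 1) - c p)
    (x y : Proj m) (hxy : x ≤ y) : ∑ p ∈ Finset.Icc x y, f p = c (y + 1) - c x := by
  have h1 : ∑ p ∈ Finset.Icc x y, f p = ∑ k ∈ Finset.Icc (x : ℕ) y, (c (k + 1) - c k) := by
    rw [← Fin.map_valEmbedding_Icc, Finset.sum_map]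
    exact Finset.sum_congr rfl fun p _ => h p
  rw [h1]
  have : ∀ y, (x : ℕ) ≤ y → ∑ k ∈ Finset.Icc (x : ℕ) y, (c (k + 1) - c k) = c (y + 1) - c x := by
    intro y hy
    induction y, hy using Nat.le_induction with
    | base => simp
    | succ y hy ih => rw [Finset.sum_Icc_succ_top (by omega), ih]; ring
  exact this y hxy

theorem backward {n m g : ℕ} (grp : Fin n → Fin g)
    (φ : (Fin n → Pref m) → Proj m → ℝ)
    (δ : (Fin g → ℕ) → Proj m → ℝ)
    (hδ : ∀ γ : Fin g → ℕ, (∀ q, γ q ≤ groupSize grp q) →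
        (∀ p, 0 ≤ δ γ p) ∧ ∑ p, δ γ p = 1)
    (h0 : δ (fun _ => 0) (Fin.last m) = 1)
    (h1 : δ (fun q => groupSize grp q) 0 = 1)
    (hmono : ∀ γ γ' : Fin g → ℕ, (∀ q, γ q ≤ groupSize grp q) → (∀ q, γ' q ≤ γ q) →
        ∀ t : Proj m,
          ∑ p ∈ Finset.univ.filter (fun p => p ≤ t), δ γ' p ≤
            ∑ p ∈ Finset.univ.filter (fun p => p ≤ t), δ γ p)
    (hφ : ∀ prof : Fin n → Pref m, (∀ i, SinglePeaked (prof i)) →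
        ∀ t : Proj m,
          φ prof t = cumAt δ prof grp ((t : ℕ) + 1) - cumAt δ prof grp (t : ℕ)) :
    (∀ prof : Fin n → Pref m, (∀ i, SinglePeaked (prof i)) →
        ∀ p : Proj m, (∀ i, topOf (prof i) = p) → φ prof p = 1) ∧
     (∀ prof : Fin n → Pref m, (∀ i, SinglePeaked (prof i)) →
        ∀ (i : Fin n) (r' : Pref m), SinglePeaked r' →
          ∀ p : Proj m,
            ∑ q ∈ upperContour (prof i) p, φ (Function.update prof i r') q ≤
              ∑ q ∈ upperContour (prof i) p, φ prof q) ∧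
     (∀ prof : Fin n → Pref m, (∀ i, SinglePeaked (prof i)) →
        ∀ π : Equiv.Perm (Fin n), (∀ i, grp (π i) = grp i) →
          φ prof = φ fun i => prof (π i)) := by
  classical
  have hc : ∀ (P Q : Fin n → Pref m) (t : ℕ), t ≤ m + 1 →
      (∀ q, alphaCount P grp q t ≤ alphaCount Q grp q t) → cumAt δ P grp t ≤ cumAt δ Q grp t := by
    intro P Q t ht h
    rcases t with _ | t
    · rw [cumAt_zero, cumAt_zero]
    · have := hmono (fun q => alphaCount Q grp q (t + 1)) (fun q => alphaCount P grp q (t + 1))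
        (fun q => alpha_le _ _ _ _) h ⟨t, by omega⟩
      rw [filter_le_eq] at this
      have e1 := cumAt_succ δ P grp ⟨t, by omega⟩
      have e2 := cumAt_succ δ Q grp ⟨t, by omega⟩
      simp only at e1 e2
      rw [e1, e2]
      exact this
  refine ⟨?_, ?_, ?_⟩
  · intro P hP p hp
    rw [hφ P hP]
    have a1 : (fun q => alphaCount P grp q ((p : ℕ) + 1)) = fun q => groupSize grp q := by
      funext q; unfold alphaCount groupSize; congr 1; ext i; simp [hp i]
    have a0 : (fun q => alphaCount P grp q (p : ℕ)) = fun q => 0 := by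
      funext q; unfold alphaCount; simp [hp]
    have c1 : cumAt δ P grp ((p : ℕ) + 1) = 1 := by
      obtain ⟨hn1, ht1⟩ := hδ (fun q => groupSize grp q) (fun q => le_rfl)
      rw [cumAt_succ, a1]
      apply le_antisymm
      · rw [← ht1]
        exact Finset.sum_le_sum_of_subset_of_nonneg (Finset.subset_univ _) fun q _ _ => hn1 q
      · rw [← h1]
        exact Finset.single_le_sum (f := δ fun q => groupSize grp q) (fun q _ => hn1 q) (by simp)
    have c0 : cumAt δ P grp (p : ℕ) = 0 := by
      obtain ⟨hn1, ht1⟩ := hδ (fun q => 0) (fun q => Nat.zero_le _)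
      rw [cumAt, a0]
      apply Finset.sum_eq_zero
      intro q hq
      have hq' : (q : ℕ) < p := (Finset.mem_filter.1 hq).2
      have hne : q ≠ Fin.last m := by
        intro h; rw [h, Fin.val_last] at hq'; omega
      have := Finset.sum_le_sum_of_subset_of_nonneg (f := δ fun _ => 0)
        (Finset.subset_univ {q, Fin.last m}) fun q _ _ => hn1 q
      rw [Finset.sum_pair hne, h0, ht1] at this
      have := hn1 q
      linarith
    rw [c1, c0]; ring
  · intro P hP i r' hr' p
    obtain ⟨x, y, hx, hy, hU⟩ := uc_interval (hP i) p
    rw [hU, sum_tele _ _ (hφ P hP) x y (hx.trans hy),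
      sum_tele _ _ (hφ _ (sp_update hP i hr')) x y (hx.trans hy)]
    have g1 : cumAt δ (Function.update P i r') grp (y + 1) ≤ cumAt δ P grp (y + 1) := by
      refine hc _ _ _ (by omega) fun q => Finset.card_le_card ?_
      intro j
      simp only [Finset.mem_filter, Finset.mem_univ, true_and]
      rintro ⟨e1, e2⟩
      refine ⟨e1, ?_⟩
      by_cases hj : j = i
      · subst hj; rw [Fin.le_def] at hy; omega
      · simpa [hj] using e2
    have g2 : cumAt δ P grp x ≤ cumAt δ (Function.update P i r') grp x := by
      refine hc _ _ _ (by omega) fun q => Finset.card_le_card ?_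
      intro j
      simp only [Finset.mem_filter, Finset.mem_univ, true_and]
      rintro ⟨e1, e2⟩
      refine ⟨e1, ?_⟩
      by_cases hj : j = i
      · subst hj; rw [Fin.le_def] at hx; omega
      · simpa [hj] using e2
    linarith
  · intro P hP π hπ
    have ha : ∀ t q, alphaCount (fun i => P (π i)) grp q t = alphaCount P grp q t := by
      intro t q
      unfold alphaCount
      refine Finset.card_bij (fun i _ => π i) ?_ ?_ ?_
      · intro i hi; simpa [hπ] using hi
      · intro i _ j _ h; exact π.injective h
      · intro j hj
        refine ⟨π.symm j, ?_, by simp⟩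
        have := hπ (π.symm j)
        rw [Equiv.apply_symm_apply] at this
        simpa [← this] using hj
    funext t
    rw [hφ P hP, hφ _ fun i => hP (π i)]
    simp only [cumAt, ha]

end PFG

/-- A random social choice rule on the single-peaked domain is unanimous,
strategy-proof and group-wise anonymous iff it is a probabilistic fixed group ballot
rule (PFGBR). -/
theorem stmt_18 {n m g : ℕ} (hn : 2 ≤ n)
    (grp : Fin n → Fin g) (hgrp : Function.Surjective grp)
    (φ : (Fin n → Pref m) → Proj m → ℝ)
    (hprob : ∀ prof : Fin n → Pref m, (∀ i, SinglePeaked (prof i)) →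
      (∀ p, 0 ≤ φ prof p) ∧ ∑ p, φ prof p = 1) :
    ((∀ prof : Fin n → Pref m, (∀ i, SinglePeaked (prof i)) →
        ∀ p : Proj m, (∀ i, topOf (prof i) = p) → φ prof p = 1) ∧
     (∀ prof : Fin n → Pref m, (∀ i, SinglePeaked (prof i)) →
        ∀ (i : Fin n) (r' : Pref m), SinglePeaked r' →
          ∀ p : Proj m,
            ∑ q ∈ upperContour (prof i) p, φ (Function.update prof i r') q ≤
              ∑ q ∈ upperContour (prof i) p, φ prof q) ∧
     (∀ prof : Fin n → Pref m, (∀ i, SinglePeaked (prof i)) →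
        ∀ π : Equiv.Perm (Fin n), (∀ i, grp (π i) = grp i) →
          φ prof = φ fun i => prof (π i)))
    ↔
    ∃ δ : (Fin g → ℕ) → Proj m → ℝ,
      (∀ γ : Fin g → ℕ, (∀ q, γ q ≤ groupSize grp q) →
        (∀ p, 0 ≤ δ γ p) ∧ ∑ p, δ γ p = 1) ∧
      δ (fun _ => 0) (Fin.last m) = 1 ∧
      δ (fun q => groupSize grp q) 0 = 1 ∧
      (∀ γ γ' : Fin g → ℕ, (∀ q, γ q ≤ groupSize grp q) → (∀ q, γ' q ≤ γ q) →
        ∀ t : Proj m,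
          ∑ p ∈ Finset.univ.filter (fun p => p ≤ t), δ γ' p ≤
            ∑ p ∈ Finset.univ.filter (fun p => p ≤ t), δ γ p) ∧
      (∀ prof : Fin n → Pref m, (∀ i, SinglePeaked (prof i)) →
        ∀ t : Proj m,
          φ prof t = cumAt δ prof grp ((t : ℕ) + 1) - cumAt δ prof grp (t : ℕ)) := by
  constructor
  · rintro ⟨h1, h2, h3⟩
    exact PFG.forward grp φ ⟨fun P hP => (hprob P hP).1, fun P hP => (hprob P hP).2, h1, h2⟩ h3
  · rintro ⟨δ, h1, h2, h3, h4, h5⟩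
    exact PFG.backward grp φ δ h1 h2 h3 h4 h5
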